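/- arXiv:2203.16818 — 3 statements merged into one kernel-verified Lean document; each statement's English description precedes it below -/
import Mathlib

section
/- Let X be a real random variable with Gaussian distribution N(μ, σ²) where σ > 0, and let b, z ∈ ℝ. Then E[X − b | X > b] ≤ σ · h(z) if and only if μ + z·σ ≤ b. -/
open MeasureTheory ProbabilityTheory

/-- The cumulative distribution function of the standard Gaussian distribution. -/
noncomputable def stdGaussianCDF (z : ℝ) : ℝ :=
  ∫ u in Set.Iic z, Real.exp (-u ^ 2 / 2) / Real.sqrt (2 * Real.pi)

/-- The function `h(z) = (e^{-z²/2}/√(2π))/(1 − Φ(z)) − z`. -/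
noncomputable def hFun (z : ℝ) : ℝ :=
  (Real.exp (-z ^ 2 / 2) / Real.sqrt (2 * Real.pi)) / (1 - stdGaussianCDF z) - z

/-- The conditional expectation `E[X − b | X > b]` for `X ∼ N(μ, σ²)`:
the integral of `x − b` over the event `{x > b}` divided by the probability of that event. -/
noncomputable def condExpExcess (μ σ b : ℝ) : ℝ :=
  (∫ x in Set.Ioi b, (x - b) ∂(gaussianReal μ ⟨σ ^ 2, sq_nonneg σ⟩)) /
    ((gaussianReal μ ⟨σ ^ 2, sq_nonneg σ⟩) (Set.Ioi b)).toReal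

section GaussianTail

open Set Filter Topology

variable {m m₁ m₂ : ℝ}

lemma setIntegral_gaussianReal_eq_setIntegral_mul {v : NNReal} (hv : v ≠ 0) {s : Set ℝ}
    (hs : MeasurableSet s) (f : ℝ → ℝ) :
    ∫ x in s, f x ∂gaussianReal m v = ∫ x in s, gaussianPDFReal m v x * f x := by
  rw [← integral_indicator hs, ← integral_indicator hs,
    integral_gaussianReal_eq_integral_smul hv]
  congr 1 with x
  by_cases hx : x ∈ s <;> simp [hx]

lemma integrable_gaussianPDFReal_mul_sub (m c : ℝ) {v : NNReal} (hv : v ≠ 0) :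
    Integrable fun x ↦ gaussianPDFReal m v x * (x - c) := by
  have h : Integrable (fun x ↦ x - c) (gaussianReal m v) :=
    ((memLp_id_gaussianReal 1).integrable le_rfl).sub (integrable_const c)
  rw [gaussianReal_of_var_ne_zero _ hv, integrable_withDensity_iff_integrable_smul'
    (measurable_gaussianPDF _ _) (ae_of_all _ fun _ ↦ gaussianPDF_lt_top)] at h
  simpa [toReal_gaussianPDF] using h

lemma gaussianReal_real_Ioi_pos (m b : ℝ) {v : NNReal} (hv : v ≠ 0) :
    0 < (gaussianReal m v).real (Ioi b) := by
  refine ENNReal.toReal_pos (fun h ↦ ?_) (measure_ne_top _ _)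
  simpa using gaussianReal_absolutelyContinuous' m hv h

lemma setIntegral_Ioi_sub_gaussianReal_one (m : ℝ) :
    ∫ x in Ioi 0, (x - m) ∂gaussianReal m 1 = gaussianPDFReal m 1 0 := by
  rw [setIntegral_gaussianReal_eq_setIntegral_mul one_ne_zero measurableSet_Ioi]
  have hderiv : ∀ x ∈ Ici (0 : ℝ), HasDerivAt (fun x ↦ -gaussianPDFReal m 1 x)
      (gaussianPDFReal m 1 x * (x - m)) x := by
    intro x _
    have h : HasDerivAt (fun x : ℝ ↦ -(x - m) ^ 2 / (2 * (1 : NNReal))) (-(x - m)) x := by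
      have := (((hasDerivAt_id x).sub_const m).pow 2).neg.div_const (2 * ((1 : NNReal) : ℝ))
      refine this.congr_deriv ?_
      simp
      ring
    refine (h.exp.const_mul (√(2 * Real.pi * (1 : NNReal)))⁻¹).neg.congr_deriv ?_
    simp only [gaussianPDFReal]
    ring
  have hlim : Tendsto (fun x ↦ -gaussianPDFReal m 1 x) atTop (𝓝 0) := by
    have h : Tendsto (fun x : ℝ ↦ (x - m) ^ 2 / 2) atTop atTop :=
      ((tendsto_pow_atTop two_ne_zero).comp
        (tendsto_atTop_add_const_right _ (-m) tendsto_id)).atTop_div_const two_pos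
    have := ((Real.tendsto_exp_neg_atTop_nhds_zero.comp h).const_mul
      (√(2 * Real.pi * (1 : NNReal)))⁻¹).neg
    simpa [gaussianPDFReal_def, Function.comp_def, neg_div] using this
  rw [integral_Ioi_of_hasDerivAt_of_tendsto' hderiv
    (integrable_gaussianPDFReal_mul_sub m m one_ne_zero).integrableOn hlim]
  ring

lemma condExpExcess_one_zero (m : ℝ) :
    condExpExcess m 1 0 =
      (∫ x in Ioi 0, x ∂gaussianReal m 1) / (gaussianReal m 1).real (Ioi 0) := by
  have h : (⟨(1 : ℝ) ^ 2, sq_nonneg 1⟩ : NNReal) = (1 : NNReal) := by ext; simp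
  simp only [condExpExcess, h, sub_zero, measureReal_def]

lemma setIntegral_Ioi_sub_const_gaussianReal (m c b : ℝ) (v : NNReal) :
    ∫ x in Ioi b, (x - c) ∂gaussianReal m v =
      (∫ x in Ioi b, x ∂gaussianReal m v) - c * (gaussianReal m v).real (Ioi b) := by
  have hid : Integrable (fun x ↦ x) (gaussianReal m v) :=
    (memLp_id_gaussianReal 1).integrable le_rfl
  rw [integral_sub hid.integrableOn (integrable_const c)]
  simp [mul_comm]

lemma condExpExcess_eq_mul (μ b : ℝ) {σ : ℝ} (hσ : 0 < σ) :
    condExpExcess μ σ b = σ * condExpExcess ((μ - b) / σ) 1 0 := by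
  have hmap : gaussianReal μ ⟨σ ^ 2, sq_nonneg σ⟩ =
      (gaussianReal ((μ - b) / σ) 1).map (fun x ↦ σ * x + b) := by
    have : (fun x ↦ σ * x + b) = (fun x ↦ x + b) ∘ (fun x ↦ σ * x) := rfl
    rw [this, ← Measure.map_map (by fun_prop) (by fun_prop), gaussianReal_map_const_mul,
      gaussianReal_map_add_const, mul_one]
    congr 1
    field_simp
    ring
  have hpre : (fun x ↦ σ * x + b) ⁻¹' Ioi b = Ioi 0 := by
    ext x
    simp [hσ]
  rw [condExpExcess_one_zero, condExpExcess, hmap,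
    setIntegral_map measurableSet_Ioi (by fun_prop) (by fun_prop),
    Measure.map_apply (by fun_prop) measurableSet_Ioi, hpre]
  simp only [add_sub_cancel_right, measureReal_def]
  rw [integral_const_mul, mul_div_assoc]

lemma one_sub_stdGaussianCDF (z : ℝ) :
    1 - stdGaussianCDF z = (gaussianReal (-z) 1).real (Ioi 0) := by
  have hcdf : stdGaussianCDF z = (gaussianReal 0 1).real (Iic z) := by
    rw [measureReal_def, gaussianReal_apply_eq_integral _ one_ne_zero,
      ENNReal.toReal_ofReal (integral_nonneg fun x ↦ gaussianPDFReal_nonneg _ _ _),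
      stdGaussianCDF]
    congr 1 with x
    simp [gaussianPDFReal, div_eq_inv_mul]
  have hmap : gaussianReal (-z) 1 = (gaussianReal 0 1).map (fun x ↦ x - z) := by
    rw [gaussianReal_map_sub_const, zero_sub]
  have hpre : (fun x ↦ x - z) ⁻¹' Ioi 0 = (Iic z)ᶜ := by
    ext x
    simp
  rw [hcdf, ← probReal_compl_eq_one_sub measurableSet_Iic, hmap,
    map_measureReal_apply (by fun_prop) measurableSet_Ioi, hpre]

lemma hFun_eq_condExpExcess (z : ℝ) : hFun z = condExpExcess (-z) 1 0 := by
  have hpos := gaussianReal_real_Ioi_pos (-z) 0 (one_ne_zero (α := NNReal))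
  have hint := setIntegral_Ioi_sub_gaussianReal_one (-z)
  rw [setIntegral_Ioi_sub_const_gaussianReal] at hint
  have hpdf : Real.exp (-z ^ 2 / 2) / √(2 * Real.pi) = gaussianPDFReal (-z) 1 0 := by
    simp [gaussianPDFReal, div_eq_inv_mul]
  rw [hFun, one_sub_stdGaussianCDF, condExpExcess_one_zero, hpdf, ← hint]
  field_simp
  ring

lemma gaussianPDFReal_one_eq_exp_mul (m₁ m₂ r x : ℝ) :
    gaussianPDFReal m₂ 1 x = gaussianPDFReal m₂ 1 r / gaussianPDFReal m₁ 1 r *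
      Real.exp ((m₂ - m₁) * (x - r)) * gaussianPDFReal m₁ 1 x := by
  have h := gaussianPDFReal_pos m₁ 1 r one_ne_zero
  rw [div_mul_eq_mul_div, div_mul_eq_mul_div, eq_div_iff h.ne']
  simp only [gaussianPDFReal]
  have hexp : ∀ c a b d e f : ℝ, a + b = d + e + f → c * Real.exp a * (c * Real.exp b) =
      c * Real.exp d * Real.exp e * (c * Real.exp f) := by
    intro c a b d e f h
    calc c * Real.exp a * (c * Real.exp b) = c * c * Real.exp (a + b) := by
          rw [Real.exp_add]; ring
      _ = _ := by rw [h, Real.exp_add, Real.exp_add]; ring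
  apply hexp
  push_cast
  ring

lemma setIntegral_Ioi_sub_lt_of_mean_lt (h : m₁ < m₂) (r : ℝ) :
    gaussianPDFReal m₂ 1 r / gaussianPDFReal m₁ 1 r *
        ∫ x in Ioi 0, (x - r) ∂gaussianReal m₁ 1 <
      ∫ x in Ioi 0, (x - r) ∂gaussianReal m₂ 1 := by
  simp only [setIntegral_gaussianReal_eq_setIntegral_mul one_ne_zero measurableSet_Ioi]
  have hk : 0 < gaussianPDFReal m₂ 1 r / gaussianPDFReal m₁ 1 r :=
    div_pos (gaussianPDFReal_pos _ _ _ one_ne_zero) (gaussianPDFReal_pos _ _ _ one_ne_zero)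
  have htilt := gaussianPDFReal_one_eq_exp_mul m₁ m₂ r
  set k := gaussianPDFReal m₂ 1 r / gaussianPDFReal m₁ 1 r
  have hi₁ := ((integrable_gaussianPDFReal_mul_sub m₁ r one_ne_zero).const_mul k).integrableOn
    (s := Ioi 0)
  have hi₂ := (integrable_gaussianPDFReal_mul_sub m₂ r one_ne_zero).integrableOn (s := Ioi 0)
  have hpos : ∀ x, x ≠ r →
      0 < gaussianPDFReal m₂ 1 x * (x - r) - k * (gaussianPDFReal m₁ 1 x * (x - r)) := by
    intro x hx
    have hp := mul_pos hk (gaussianPDFReal_pos m₁ 1 x one_ne_zero)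
    have key : 0 < (Real.exp ((m₂ - m₁) * (x - r)) - 1) * (x - r) := by
      rcases hx.lt_or_gt with hx | hx
      · refine mul_pos_of_neg_of_neg (sub_neg.2 (Real.exp_lt_one_iff.2 ?_)) (sub_neg.2 hx)
        exact mul_neg_of_pos_of_neg (sub_pos.2 h) (sub_neg.2 hx)
      · refine mul_pos (sub_pos.2 (Real.one_lt_exp_iff.2 ?_)) (sub_pos.2 hx)
        exact mul_pos (sub_pos.2 h) (sub_pos.2 hx)
    rw [htilt x]
    linarith [mul_pos hp key]
  rw [← integral_const_mul, ← sub_pos, ← integral_sub hi₂ hi₁]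
  refine (setIntegral_pos_iff_support_of_nonneg_ae (ae_of_all _ fun x ↦ ?_)
    (Integrable.sub hi₂ hi₁)).2 ?_
  · rcases eq_or_ne x r with rfl | hx
    · simp
    · exact (hpos x hx).le
  · have hsub : Ioi (max 0 r) ⊆ Function.support (fun x ↦ gaussianPDFReal m₂ 1 x * (x - r) -
        k * (gaussianPDFReal m₁ 1 x * (x - r))) ∩ Ioi 0 := fun x hx ↦
      ⟨(hpos x ((le_max_right _ _).trans_lt hx).ne').ne', mem_Ioi.2 ((le_max_left _ _).trans_lt hx)⟩
    exact lt_of_lt_of_le (by simp) (measure_mono hsub)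

lemma strictMono_condExpExcess_one_zero : StrictMono fun m ↦ condExpExcess m 1 0 := by
  intro m₁ m₂ h
  have hP₁ := gaussianReal_real_Ioi_pos m₁ 0 (one_ne_zero (α := NNReal))
  have hP₂ := gaussianReal_real_Ioi_pos m₂ 0 (one_ne_zero (α := NNReal))
  have hlt := setIntegral_Ioi_sub_lt_of_mean_lt h (condExpExcess m₁ 1 0)
  rw [setIntegral_Ioi_sub_const_gaussianReal, setIntegral_Ioi_sub_const_gaussianReal,
    show (∫ x in Ioi 0, x ∂gaussianReal m₁ 1) -
      condExpExcess m₁ 1 0 * (gaussianReal m₁ 1).real (Ioi 0) = 0 by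
        rw [condExpExcess_one_zero, div_mul_cancel₀ _ hP₁.ne', sub_self],
    mul_zero, sub_pos, ← lt_div_iff₀ hP₂, ← condExpExcess_one_zero] at hlt
  exact hlt

end GaussianTail

theorem stmt_4 (μ σ b z : ℝ) (hσ : 0 < σ) :
    condExpExcess μ σ b ≤ σ * hFun z ↔ μ + z * σ ≤ b := by
  rw [condExpExcess_eq_mul μ b hσ, hFun_eq_condExpExcess, mul_le_mul_iff_right₀ hσ,
    strictMono_condExpExcess_one_zero.le_iff_le, div_le_iff₀ hσ]
  constructor <;> intro h <;> linarith
end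

section
/- The function h defined by h(z) = (e^{-z²/2}/√(2π))/(1 − Φ(z)) − z is strictly decreasing on ℝ; that is, for all real z₁ < z₂, h(z₁) > h(z₂). -/
open MeasureTheory ProbabilityTheory Filter Topology

theorem StrictAnti.pos_of_tendsto_atTop_zero {f : ℝ → ℝ} (hf : StrictAnti f)
    (hlim : Tendsto f atTop (𝓝 0)) (x : ℝ) : 0 < f x :=
  (hf.antitone.le_of_tendsto hlim (x + 1)).trans_lt (hf (lt_add_one x))

theorem gaussianPDFReal_zero_one (z : ℝ) :
    gaussianPDFReal 0 1 z = Real.exp (-z ^ 2 / 2) / Real.sqrt (2 * Real.pi) := by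
  simp [gaussianPDFReal, div_eq_inv_mul]

theorem stdGaussianCDF_eq (z : ℝ) :
    stdGaussianCDF z = ∫ u in Set.Iic z, gaussianPDFReal 0 1 u := by
  simp only [stdGaussianCDF, gaussianPDFReal_zero_one]

theorem hasDerivAt_gaussianPDFReal_zero_one (z : ℝ) :
    HasDerivAt (gaussianPDFReal 0 1) (-z * gaussianPDFReal 0 1 z) z := by
  have h : HasDerivAt (fun u : ℝ => -u ^ 2 / 2) (-z) z := by
    refine ((hasDerivAt_pow 2 z).neg.div_const 2).congr_deriv ?_
    norm_num
    ring
  rw [show gaussianPDFReal 0 1 = _ from funext gaussianPDFReal_zero_one]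
  refine (h.exp.div_const (Real.sqrt (2 * Real.pi))).congr_deriv ?_
  ring

theorem hasDerivAt_stdGaussianCDF (z : ℝ) :
    HasDerivAt stdGaussianCDF (gaussianPDFReal 0 1 z) z := by
  have hc : Continuous (gaussianPDFReal 0 1) :=
    continuous_iff_continuousAt.2 fun u => (hasDerivAt_gaussianPDFReal_zero_one u).continuousAt
  have hi := integrable_gaussianPDFReal 0 1
  have heq : stdGaussianCDF =
      fun w => stdGaussianCDF 0 + ∫ u in (0 : ℝ)..w, gaussianPDFReal 0 1 u := by
    funext w
    rw [← intervalIntegral.integral_Iic_sub_Iic hi.integrableOn hi.integrableOn,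
      stdGaussianCDF_eq, stdGaussianCDF_eq]
    ring
  rw [heq]
  exact (hc.integral_hasStrictDerivAt 0 z).hasDerivAt.const_add _

theorem hasDerivAt_one_sub_stdGaussianCDF (z : ℝ) :
    HasDerivAt (fun w => 1 - stdGaussianCDF w) (-gaussianPDFReal 0 1 z) z :=
  (hasDerivAt_stdGaussianCDF z).const_sub 1

theorem tendsto_one_sub_stdGaussianCDF :
    Tendsto (fun z => 1 - stdGaussianCDF z) atTop (𝓝 0) := by
  have h := (aecover_Iic (μ := (volume : Measure ℝ)) tendsto_id
    ).integral_tendsto_of_countably_generated (integrable_gaussianPDFReal 0 1)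
  rw [integral_gaussianPDFReal_eq_one 0 one_ne_zero] at h
  simpa [stdGaussianCDF_eq] using h.const_sub 1

theorem one_sub_stdGaussianCDF_pos (z : ℝ) : 0 < 1 - stdGaussianCDF z :=
  (strictAnti_of_hasDerivAt_neg hasDerivAt_one_sub_stdGaussianCDF fun w =>
    neg_neg_of_pos (gaussianPDFReal_pos 0 1 w one_ne_zero)).pos_of_tendsto_atTop_zero
    tendsto_one_sub_stdGaussianCDF z

theorem tendsto_mul_gaussianPDFReal_zero_one :
    Tendsto (fun z => z * gaussianPDFReal 0 1 z) atTop (𝓝 0) := by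
  have h := (tendsto_rpow_abs_mul_exp_neg_mul_sq_cocompact
    (show (0 : ℝ) < 1 / 2 by norm_num) 1).mono_left atTop_le_cocompact
  have h' := h.div_const (Real.sqrt (2 * Real.pi))
  rw [zero_div] at h'
  refine h'.congr' ?_
  filter_upwards [eventually_ge_atTop 0] with z hz
  rw [gaussianPDFReal_zero_one, Real.rpow_one, abs_of_nonneg hz, mul_div_assoc]
  ring_nf

theorem tendsto_gaussianPDFReal_zero_one :
    Tendsto (gaussianPDFReal 0 1) atTop (𝓝 0) := by
  refine tendsto_of_tendsto_of_tendsto_of_le_of_le' tendsto_const_nhds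
    tendsto_mul_gaussianPDFReal_zero_one
    (Eventually.of_forall fun z => gaussianPDFReal_nonneg 0 1 z) ?_
  filter_upwards [eventually_ge_atTop 1] with z hz
  exact le_mul_of_one_le_left (gaussianPDFReal_nonneg 0 1 z) hz

/-- A lower bound for the Gaussian tail. -/
theorem mul_gaussianPDFReal_lt (z : ℝ) :
    z * gaussianPDFReal 0 1 z < (1 + z ^ 2) * (1 - stdGaussianCDF z) := by
  have hd : ∀ w, HasDerivAt
      (fun w => (1 - stdGaussianCDF w) - w * gaussianPDFReal 0 1 w / (1 + w ^ 2))
      (-(2 * gaussianPDFReal 0 1 w / (1 + w ^ 2) ^ 2)) w := by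
    intro w
    have hw : 1 + w ^ 2 ≠ 0 := by positivity
    refine ((hasDerivAt_one_sub_stdGaussianCDF w).sub
      (((hasDerivAt_id w).mul (hasDerivAt_gaussianPDFReal_zero_one w)).div
        ((hasDerivAt_pow 2 w).const_add 1) hw)).congr_deriv ?_
    simp only [id, Pi.mul_apply]
    field_simp
    ring
  have hlim : Tendsto
      (fun w => (1 - stdGaussianCDF w) - w * gaussianPDFReal 0 1 w / (1 + w ^ 2))
      atTop (𝓝 0) := by
    have h : Tendsto (fun w => w * gaussianPDFReal 0 1 w / (1 + w ^ 2)) atTop (𝓝 0) := by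
      refine tendsto_of_tendsto_of_tendsto_of_le_of_le' tendsto_const_nhds
        tendsto_mul_gaussianPDFReal_zero_one ?_ ?_ <;>
      filter_upwards [eventually_ge_atTop 0] with w hw <;>
      have := mul_nonneg hw (gaussianPDFReal_nonneg 0 1 w)
      · positivity
      · exact div_le_self this (by nlinarith)
    simpa using tendsto_one_sub_stdGaussianCDF.sub h
  have hpos := (strictAnti_of_hasDerivAt_neg hd fun w => by
    have := gaussianPDFReal_pos 0 1 w one_ne_zero
    exact neg_neg_of_pos (by positivity)).pos_of_tendsto_atTop_zero hlim z
  rw [sub_pos, div_lt_iff₀ (by positivity)] at hpos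
  linarith

/-- The variance of the standard Gaussian conditioned on `(z, ∞)` is positive. -/
theorem truncated_gaussian_variance_pos (z : ℝ) :
    0 < (1 - stdGaussianCDF z) ^ 2 + z * gaussianPDFReal 0 1 z * (1 - stdGaussianCDF z)
      - gaussianPDFReal 0 1 z ^ 2 := by
  have hd : ∀ w, HasDerivAt
      (fun w => (1 - stdGaussianCDF w) ^ 2
        + w * gaussianPDFReal 0 1 w * (1 - stdGaussianCDF w) - gaussianPDFReal 0 1 w ^ 2)
      (-(gaussianPDFReal 0 1 w *
        ((1 + w ^ 2) * (1 - stdGaussianCDF w) - w * gaussianPDFReal 0 1 w))) w := by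
    intro w
    have hQ := hasDerivAt_one_sub_stdGaussianCDF w
    have hp := hasDerivAt_gaussianPDFReal_zero_one w
    refine (((hQ.pow 2).add (((hasDerivAt_id w).mul hp).mul hQ)).sub (hp.pow 2)).congr_deriv ?_
    simp only [id, Pi.mul_apply]
    ring
  have hlim := ((tendsto_one_sub_stdGaussianCDF.pow 2).add
    (tendsto_mul_gaussianPDFReal_zero_one.mul tendsto_one_sub_stdGaussianCDF)).sub
    (tendsto_gaussianPDFReal_zero_one.pow 2)
  norm_num at hlim
  exact (strictAnti_of_hasDerivAt_neg hd fun w => neg_neg_of_pos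
    (mul_pos (gaussianPDFReal_pos 0 1 w one_ne_zero)
      (sub_pos.2 (mul_gaussianPDFReal_lt w)))).pos_of_tendsto_atTop_zero hlim z

theorem hasDerivAt_hFun (z : ℝ) :
    HasDerivAt hFun (-(((1 - stdGaussianCDF z) ^ 2
      + z * gaussianPDFReal 0 1 z * (1 - stdGaussianCDF z) - gaussianPDFReal 0 1 z ^ 2)
      / (1 - stdGaussianCDF z) ^ 2)) z := by
  have hQ := (one_sub_stdGaussianCDF_pos z).ne'
  have heq : hFun = fun w => gaussianPDFReal 0 1 w / (1 - stdGaussianCDF w) - w := by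
    funext w
    rw [hFun, gaussianPDFReal_zero_one]
  rw [heq]
  refine (((hasDerivAt_gaussianPDFReal_zero_one z).div
    (hasDerivAt_one_sub_stdGaussianCDF z) hQ).sub (hasDerivAt_id z)).congr_deriv ?_
  field_simp
  ring

theorem stmt_5 : ∀ z₁ z₂ : ℝ, z₁ < z₂ → hFun z₁ > hFun z₂ := by
  intro z₁ z₂ h
  exact strictAnti_of_hasDerivAt_neg hasDerivAt_hFun (fun z => neg_neg_of_pos
    (div_pos (truncated_gaussian_variance_pos z) (pow_pos (one_sub_stdGaussianCDF_pos z) 2))) h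
end

section
/- Let n, k ≥ 1, let ā_{t} ∈ ℝ^k and K_{t} be k×k real symmetric positive semidefinite matrices for t = 1, …, n, let γ_{t} ∈ ℝ^k be the vector of square roots of the diagonal entries of K_{t}, let ψ ≥ 0 and b ∈ ℝ. Suppose x_1, …, x_n ∈ {0,1}^k each satisfy 1ᵀx_t ≤ 1. If the second-order cone constraint Σ_{t=1}^n ā_{t}ᵀ x_t + ψ·√(Σ_{t=1}^n x_tᵀ K_{t} x_t) ≤ b holds, then the linearized constraint Σ_{t=1}^n ( ā_{t} + (ψ/√n)·γ_{t} )ᵀ x_t ≤ b also holds. Consequently every feasible solution of the integer second-order cone program is feasible for the relaxed integer linear program. -/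
open Matrix BigOperators

theorem eq_zero_or_eq_single_of_sum_le_one {ι : Type*} [Fintype ι] [DecidableEq ι] {x : ι → ℝ}
    (h01 : ∀ i, x i = 0 ∨ x i = 1) (hsum : ∑ i, x i ≤ 1) :
    x = 0 ∨ ∃ i, x = Pi.single i 1 := by
  by_cases h : ∃ i, x i = 1
  · obtain ⟨i, hi⟩ := h
    refine Or.inr ⟨i, funext fun j => ?_⟩
    have hnonneg : ∀ j, 0 ≤ x j := fun j => by rcases h01 j with h | h <;> simp [h]
    rcases eq_or_ne j i with rfl | hji
    · simpa using hi
    · have hle : x i + x j ≤ ∑ l, x l := by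
        rw [← Finset.sum_pair hji.symm]
        exact Finset.sum_le_sum_of_subset_of_nonneg (Finset.subset_univ _) fun l _ _ => hnonneg l
      rw [Pi.single_eq_of_ne hji]
      linarith [hnonneg j]
  · push Not at h
    exact Or.inl (funext fun i => (h01 i).resolve_right (h i))

theorem sq_sqrt_diag_dotProduct {ι : Type*} [Fintype ι] {K : Matrix ι ι ℝ}
    (hK : K.PosSemidef) {x : ι → ℝ} (h01 : ∀ i, x i = 0 ∨ x i = 1) (hsum : ∑ i, x i ≤ 1) :
    ((fun i => √(K i i)) ⬝ᵥ x) ^ 2 = x ⬝ᵥ K *ᵥ x := by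
  classical
  rcases eq_zero_or_eq_single_of_sum_le_one h01 hsum with rfl | ⟨i, rfl⟩
  · simp
  · simp [Real.sq_sqrt hK.diag_nonneg]

theorem sum_div_sqrt_card_le_sqrt_sum_sq {ι : Type*} [Fintype ι] (s : ι → ℝ) :
    (∑ i, s i) / √(Fintype.card ι) ≤ √(∑ i, s i ^ 2) := by
  refine div_le_of_le_mul₀ (Real.sqrt_nonneg _) (Real.sqrt_nonneg _) ?_
  rw [mul_comm, ← Real.sqrt_mul (Nat.cast_nonneg _)]
  exact Real.le_sqrt_of_sq_le (by simpa using sq_sum_le_card_mul_sum_sq (s := Finset.univ) (f := s))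

theorem stmt_7 (n k : ℕ) (hn : 1 ≤ n) (hk : 1 ≤ k)
    (abar : Fin n → Fin k → ℝ)
    (K : Fin n → Matrix (Fin k) (Fin k) ℝ)
    (hK : ∀ t, (K t).PosSemidef)
    (γ : Fin n → Fin k → ℝ) (hγ : ∀ t l, γ t l = Real.sqrt (K t l l))
    (ψ : ℝ) (hψ : 0 ≤ ψ) (b : ℝ)
    (x : Fin n → Fin k → ℝ)
    (hx01 : ∀ t l, x t l = 0 ∨ x t l = 1)
    (hx1 : ∀ t, ∑ l, x t l ≤ 1)
    (hsoc : ∑ t, abar t ⬝ᵥ x t +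
        ψ * Real.sqrt (∑ t, x t ⬝ᵥ (K t).mulVec (x t)) ≤ b) :
    ∑ t, (fun l => abar t l + ψ / Real.sqrt n * γ t l) ⬝ᵥ x t ≤ b := by
  have hquad : ∀ t, x t ⬝ᵥ K t *ᵥ x t = (γ t ⬝ᵥ x t) ^ 2 := fun t => by
    rw [funext (hγ t), sq_sqrt_diag_dotProduct (hK t) (hx01 t) (hx1 t)]
  have hlin : ∑ t, (fun l => abar t l + ψ / √n * γ t l) ⬝ᵥ x t =
      ∑ t, abar t ⬝ᵥ x t + ψ * ((∑ t, γ t ⬝ᵥ x t) / √n) := by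
    have hsplit : ∀ t, (fun l => abar t l + ψ / √n * γ t l) ⬝ᵥ x t =
        abar t ⬝ᵥ x t + ψ / √n * (γ t ⬝ᵥ x t) := fun t => by
      rw [← smul_eq_mul, ← smul_dotProduct, ← add_dotProduct]
      rfl
    simp only [hsplit, Finset.sum_add_distrib, ← Finset.mul_sum]
    ring
  have hcs := sum_div_sqrt_card_le_sqrt_sum_sq fun t => γ t ⬝ᵥ x t
  rw [Fintype.card_fin] at hcs
  simp only [hquad] at hsoc
  rw [hlin]
  linarith [mul_le_mul_of_nonneg_left hcs hψ]
end
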